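/- Fix an integer p ≥ 2. In the ring ℝ[[X]] of formal power series in one variable, the power series T_p := Σ_{k ≥ 0} F_p(k)·X^k satisfies the equation T_p = 1 + X·T_p^p. -/

import Mathlib

open scoped BigOperators

noncomputable section

/-- Fuss–Catalan numbers `F_p(k) = (1/(pk+1)) * choose (pk+1) k`. -/
def fussCatalan (p k : ℕ) : ℝ := ((p * k + 1).choose k : ℝ) / (p * k + 1)

/-- Raney numbers `r / (pk + r) * choose (pk + r) k`, the coefficients of the `r`-th power of the
Fuss–Catalan generating series; the value at `k = 0` is `1` for every `r`, including `r = 0`. -/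
def raney (p r k : ℕ) : ℝ :=
  if k = 0 then 1 else (r : ℝ) / (p * k + r) * ((p * k + r).choose k : ℝ)

@[simp]
theorem raney_zero_right (p r : ℕ) : raney p r 0 = 1 := by
  simp [raney]

theorem raney_of_add_pos {p r k : ℕ} (h : 0 < k + r) :
    raney p r k = (r : ℝ) / (p * k + r) * ((p * k + r).choose k : ℝ) := by
  rcases Nat.eq_zero_or_pos k with rfl | hk
  · have hr : (r : ℝ) ≠ 0 := by
      have : r ≠ 0 := by omega
      exact_mod_cast this
    simp [raney, hr]
  · simp [raney, hk.ne']

theorem raney_one (p k : ℕ) : raney p 1 k = fussCatalan p k := by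
  rw [raney_of_add_pos (by omega), fussCatalan]
  push_cast
  ring

theorem raney_succ_succ {p : ℕ} (hp : 0 < p) (r k : ℕ) :
    raney p (r + 1) (k + 1) = raney p r (k + 1) + raney p (r + p) k := by
  rw [raney_of_add_pos (by omega), raney_of_add_pos (by omega), raney_of_add_pos (by omega)]
  obtain ⟨m, hm⟩ : ∃ m, m = p * (k + 1) + r := ⟨_, rfl⟩
  have hkm : k < m := by nlinarith
  have h₁ : p * (k + 1) + (r + 1) = m + 1 := by omega
  have h₂ : p * k + (r + p) = m := by rw [hm]; ring
  have hmR : (m : ℝ) = p * (k + 1) + r := by exact_mod_cast hm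
  have hsymm : ((m.choose (k + 1) : ℕ) : ℝ) * (k + 1) = m.choose k * (m - k) := by
    rw [← Nat.cast_sub hkm.le]
    exact_mod_cast Nat.choose_succ_right_eq m k
  have hm0 : (m : ℝ) ≠ 0 := by
    have : m ≠ 0 := by omega
    exact_mod_cast this
  have hm1 : (m : ℝ) + 1 ≠ 0 := by positivity
  have hk1 : (k : ℝ) + 1 ≠ 0 := by positivity
  rw [h₁, h₂, ← hm, Nat.choose_succ_succ']
  push_cast
  rw [show (p : ℝ) * (k + 1) + (r + 1) = m + 1 by rw [hmR]; ring,
    show (p : ℝ) * k + (r + p) = m by rw [hmR]; ring, ← hmR]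
  rw [eq_div_of_mul_eq hk1 hsymm]
  field_simp
  rw [hmR]
  ring

/-- The generating series of the Raney numbers with parameters `p` and `r`. -/
def raneySeries (p r : ℕ) : PowerSeries ℝ :=
  PowerSeries.mk (raney p r)

@[simp]
theorem coeff_raneySeries (p r k : ℕ) : (raneySeries p r).coeff k = raney p r k :=
  PowerSeries.coeff_mk _ _

@[simp]
theorem constantCoeff_raneySeries (p r : ℕ) : (raneySeries p r).constantCoeff = 1 := by
  rw [← PowerSeries.coeff_zero_eq_constantCoeff_apply, coeff_raneySeries, raney_zero_right]

theorem raneySeries_zero (p : ℕ) : raneySeries p 0 = 1 := by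
  ext k
  simp [raney, PowerSeries.coeff_one]

theorem raneySeries_succ {p : ℕ} (hp : 0 < p) (r : ℕ) :
    raneySeries p (r + 1) = raneySeries p r + PowerSeries.X * raneySeries p (r + p) := by
  ext k
  cases k with
  | zero => simp
  | succ k => simp [PowerSeries.coeff_succ_X_mul, raney_succ_succ hp]

theorem raneySeries_add {p : ℕ} (hp : 0 < p) (r s : ℕ) :
    raneySeries p (r + s) = raneySeries p r * raneySeries p s := by
  ext k
  induction k generalizing r with
  | zero => simp
  | succ k ihk =>
    induction r with
    | zero => simp [raneySeries_zero]
    | succ r ihr =>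
      rw [add_right_comm, raneySeries_succ hp, raneySeries_succ hp r, add_mul, mul_assoc,
        map_add, map_add, PowerSeries.coeff_succ_X_mul, PowerSeries.coeff_succ_X_mul, ihr,
        add_right_comm, ihk]

theorem raneySeries_eq_pow {p : ℕ} (hp : 0 < p) (r : ℕ) :
    raneySeries p r = raneySeries p 1 ^ r := by
  induction r with
  | zero => rw [raneySeries_zero, pow_zero]
  | succ r ih => rw [raneySeries_add hp, ih, pow_succ]

/-- **Generating series of the Fuss–Catalan numbers.** In `ℝ[[X]]`, the power series
`T_p = Σ_k F_p(k) X^k` satisfies `T_p = 1 + X T_p^p`. -/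
theorem fussCatalan_powerSeries_identity (p : ℕ) (hp : 2 ≤ p) :
    (PowerSeries.mk fun k => fussCatalan p k : PowerSeries ℝ) =
      1 + PowerSeries.X * (PowerSeries.mk fun k => fussCatalan p k : PowerSeries ℝ) ^ p := by
  have hp₀ : 0 < p := by omega
  have hT : (PowerSeries.mk fun k => fussCatalan p k) = raneySeries p 1 :=
    congrArg PowerSeries.mk (funext fun k => (raney_one p k).symm)
  rw [hT, ← raneySeries_eq_pow hp₀]
  simpa [raneySeries_zero] using raneySeries_succ hp₀ 0
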